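/- (Lemma 2) For every n ∈ ℤ and all integers m, k ≥ 1, the (k+1)×(k+1) determinant D(n, m, s, k) = det( f(n+m·i, x, s)^j · f(n+m·i−1, x, q·s)^{k−j} )_{i,j=0}^{k} (row index i, column index j) equals (−1)^{binom(k+1,2)·n + binom(k+1,3)·m} · s^{binom(k+1,2)(n−1) + binom(k+1,3)·m} · q^{binom(k+1,2)·binom(n,2) + binom(k+1,3)·(binom(m,2) + n·m) + binom(k+1,4)·m^2} · ∏_{j=0}^{k−1} fac(k−j, x, q^{m·j+n}·s, m), where binom(n,2) = n(n−1)/2 for n ∈ ℤ and powers of s and q with possibly negative integer exponents are interpreted as integer powers of nonzero field elements. -/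

import Mathlib

open Finset

variable {K : Type*} [Field K]

noncomputable def qFibPos (q x t : K) : ℕ → K
  | 0 => 0
  | 1 => 1
  | n + 2 => x * qFibPos q x t (n + 1) + q ^ n * t * qFibPos q x t n

noncomputable def qFibNeg (q x t : K) : ℕ → K
  | 0 => 0
  | 1 => q / t
  | m + 2 => (qFibNeg q x t m - x * qFibNeg q x t (m + 1)) * q ^ (m + 2) / t

/-- The Carlitz q-Fibonacci polynomial `f(n, x, t)` for `n : ℤ`, defined by `f 0 = 0`,
`f 1 = 1` and `f n = x * f (n-1) + q^(n-2) * t * f (n-2)`, solved backwards for `n < 0`. -/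
noncomputable def qFib (q x t : K) : ℤ → K
  | Int.ofNat n => qFibPos q x t n
  | Int.negSucc m => qFibNeg q x t (m + 1)

/-- `fac(k, x, t, m) = ∏_{i=1}^{k} f(i·m, x, t)`. -/
noncomputable def qFac (q x t : K) (k m : ℕ) : K :=
  ∏ i ∈ Finset.range k, qFib q x t (((i : ℤ) + 1) * m)

/-- The determinant `D(n, m, s, k) = det( f(n+mi,x,s)^j · f(n+mi-1,x,qs)^{k-j} )_{i,j=0}^{k}`. -/
noncomputable def Ddet (q x s : K) (n : ℤ) (m k : ℕ) : K :=
  Matrix.det (Matrix.of fun i j : Fin (k + 1) =>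
    qFib q x s (n + m * (i : ℕ)) ^ (j : ℕ) *
      qFib q x (q * s) (n + m * (i : ℕ) - 1) ^ (k - (j : ℕ)))

theorem qFib_ofNat' (q x t : K) (n : ℕ) : qFib q x t (n : ℤ) = qFibPos q x t n := rfl

theorem qFib_neg' (q x t : K) (n : ℕ) : qFib q x t (-(n : ℤ)) = qFibNeg q x t n := by
  cases n with
  | zero => exact rfl
  | succ m => rfl

theorem qFib_zero' (q x t : K) : qFib q x t 0 = 0 := by
  have := qFib_ofNat' q x t 0
  simpa [qFibPos] using this

theorem qFib_one' (q x t : K) : qFib q x t 1 = 1 := by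
  have := qFib_ofNat' q x t 1
  simpa [qFibPos] using this

theorem qFib_rec (q x t : K) (hq : q ≠ 0) (ht : t ≠ 0) (n : ℤ) :
    qFib q x t (n + 2) = x * qFib q x t (n + 1) + q ^ n * t * qFib q x t n := by
  obtain ⟨a, rfl | rfl⟩ := n.eq_nat_or_neg
  · have h1 := qFib_ofNat' q x t (a + 2)
    have h2 := qFib_ofNat' q x t (a + 1)
    push_cast at h1 h2
    rw [h1, h2, qFib_ofNat', qFibPos, zpow_natCast]
  · rcases a with _ | _ | m
    · have h1 := qFib_ofNat' q x t 2
      have h2 := qFib_ofNat' q x t 1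
      push_cast at h1 h2
      simp [h1, h2, qFib_zero', qFibPos]
    · have h1 := qFib_neg' q x t 1
      push_cast at h1
      simp [qFib_zero', qFib_one', h1, qFibNeg]
      field_simp
    · have e1 : -((m + 1 + 1 : ℕ) : ℤ) + 2 = -(m : ℤ) := by push_cast; ring
      have e2 : -((m + 1 + 1 : ℕ) : ℤ) + 1 = -((m + 1 : ℕ) : ℤ) := by push_cast; ring
      rw [e1, e2, qFib_neg', qFib_neg', qFib_neg', qFibNeg, zpow_neg, zpow_natCast]
      field_simp
      ring

/-- Triangular number. -/
def tri (n : ℤ) : ℤ := n * (n - 1) / 2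

theorem two_tri (n : ℤ) : 2 * tri n = n * (n - 1) := by
  have : (2 : ℤ) ∣ n * (n - 1) := by
    have := Int.even_mul_pred_self n
    exact this.two_dvd
  exact Int.mul_ediv_cancel' this

theorem tri_add (a b : ℤ) : tri (a + b) = tri a + tri b + a * b := by
  have h1 := two_tri a
  have h2 := two_tri b
  have h3 := two_tri (a + b)
  have : 2 * tri (a + b) = 2 * (tri a + tri b + a * b) := by
    rw [h3, mul_add, mul_add, h1, h2]; ring
  omega

theorem tri_mul (m : ℤ) (i : ℕ) : tri (m * i) = i * tri m + (i.choose 2 : ℤ) * m ^ 2 := by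
  induction i with
  | zero => simp [tri]
  | succ i ih =>
    have : m * ((i + 1 : ℕ) : ℤ) = m * i + m := by push_cast; ring
    rw [this, tri_add, ih, Nat.choose_succ_succ' i 1]
    push_cast [Nat.choose_one_right]
    ring

/-- The Wronskian-type factor. -/
noncomputable def wfac (q s : K) (n : ℤ) : K := (-1) ^ n * s ^ (n - 1) * q ^ tri n

theorem wfac_succ (q s : K) (hq : q ≠ 0) (hs : s ≠ 0) (n : ℤ) :
    wfac q s (n + 1) = - (q ^ n * s) * wfac q s n := by
  have h1 : tri (n + 1) = tri n + n := by
    rw [tri_add]; simp [tri]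
  have h2 : n + 1 - 1 = (n - 1) + 1 := by ring
  have h3 : (-1 : K) ≠ 0 := by simp
  rw [wfac, wfac, h1, h2, zpow_add₀ hq, zpow_add_one₀ hs, zpow_add_one₀ h3]
  ring

theorem wronsk (q x s : K) (hq : q ≠ 0) (hs : s ≠ 0) (n : ℤ) :
    qFib q x s (n + 1) * qFib q x (q * s) (n - 1) - qFib q x s n * qFib q x (q * s) n
      = wfac q s n := by
  have step : ∀ n : ℤ,
      qFib q x s (n + 1 + 1) * qFib q x (q * s) (n + 1 - 1)
        - qFib q x s (n + 1) * qFib q x (q * s) (n + 1) =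
      - (q ^ n * s) * (qFib q x s (n + 1) * qFib q x (q * s) (n - 1)
        - qFib q x s n * qFib q x (q * s) n) := by
    intro n
    have r1 := qFib_rec q x s hq hs n
    have r2 := qFib_rec q x (q * s) hq (mul_ne_zero hq hs) (n - 1)
    have e1 : n - 1 + 2 = n + 1 := by ring
    have e2 : n - 1 + 1 = n := by ring
    have e3 : n + 1 + 1 = n + 2 := by ring
    have e4 : n + 1 - 1 = n := by ring
    have e5 : q ^ n = q ^ (n - 1) * q := by rw [← zpow_add_one₀ hq, e2]
    rw [e1, e2] at r2
    rw [e3, e4, r1, r2, e5]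
    ring
  induction n using Int.induction_on with
  | zero =>
    have h := step 0
    have w := wfac_succ q s hq hs 0
    have w1 : wfac q s (0 + 1) = -1 := by simp [wfac, tri]
    rw [w1] at w
    simp only [zero_add, sub_self, qFib_zero', qFib_one'] at h
    have hh : - (q ^ (0 : ℤ) * s) ≠ 0 := by simpa using hs
    apply mul_left_cancel₀ hh
    rw [← w]
    simp only [zero_add, qFib_zero', qFib_one']
    rw [← h]
    simp
  | succ i ih => rw [step, ih, wfac_succ q s hq hs]
  | pred i ih =>
    have h := step (-(i : ℤ) - 1)
    have w := wfac_succ q s hq hs (-(i : ℤ) - 1)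
    have e : -(i : ℤ) - 1 + 1 = -i := by ring
    rw [e] at h w
    rw [ih, w] at h
    have hh : - (q ^ (-(i : ℤ) - 1) * s) ≠ 0 := neg_ne_zero.2 (mul_ne_zero (zpow_ne_zero _ hq) hs)
    rw [e]
    exact (mul_left_cancel₀ hh h).symm

theorem cross (q x s : K) (hq : q ≠ 0) (hs : s ≠ 0) (n : ℤ) (M : ℕ) :
    qFib q x s (n + M) * qFib q x (q * s) (n - 1)
      - qFib q x s n * qFib q x (q * s) (n + M - 1)
      = wfac q s n * qFib q x (q ^ n * s) M := by
  induction M using Nat.twoStepInduction with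
  | zero => simp [qFib_zero', mul_comm]
  | one =>
    have := wronsk q x s hq hs n
    simpa [qFib_one'] using this
  | more M h0 h1 =>
    have r1 := qFib_rec q x s hq hs (n + M)
    have r2 := qFib_rec q x (q * s) hq (mul_ne_zero hq hs) (n + M - 1)
    have r3 := qFib_rec q x (q ^ n * s) hq (mul_ne_zero (zpow_ne_zero _ hq) hs) M
    have e5 : q ^ (n + M) = q ^ (n + M - 1) * q := by
      rw [← zpow_add_one₀ hq]; congr 1; ring
    have e6 : q ^ (n + M) = q ^ n * q ^ (M : ℤ) := zpow_add₀ hq _ _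
    have e1 : n + ((M + 1 : ℕ) : ℤ) = n + M + 1 := by push_cast; ring
    have e2 : n + ((M + 2 : ℕ) : ℤ) = n + M + 2 := by push_cast; ring
    have e3 : n + (M : ℤ) + 1 - 1 = n + M - 1 + 1 := by ring
    have e4 : n + (M : ℤ) + 2 - 1 = n + M - 1 + 2 := by ring
    have e7 : ((M + 2 : ℕ) : ℤ) = M + 2 := by push_cast; ring
    have e8 : ((M + 1 : ℕ) : ℤ) = M + 1 := by push_cast; ring
    rw [e1, e8, e3] at h1
    rw [e2, e7, e4, r1, r2, r3]
    have e9 : q ^ (n + M - 1) * (q * s) = q ^ (n + M) * s := by rw [e5]; ring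
    rw [e9]
    have e10 : q ^ (M : ℤ) * (q ^ n * s) = q ^ (n + M) * s := by rw [e6]; ring
    rw [e10]
    linear_combination x * h1 + q ^ (n + M) * s * h0

theorem comb {y z w : K} (hy : y ≠ 0) (hz : z ≠ 0) (hw : w ≠ 0) {a b c d e f g h i : ℤ}
    (h1 : g = a + d) (h2 : h = b + e) (h3 : i = c + f) :
    y ^ g * z ^ h * w ^ i = y ^ a * z ^ b * w ^ c * (y ^ d * z ^ e * w ^ f) := by
  rw [h1, h2, h3, zpow_add₀ hy, zpow_add₀ hz, zpow_add₀ hw]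
  ring

theorem prod_w (q s : K) (hq : q ≠ 0) (hs : s ≠ 0) (n : ℤ) (m k : ℕ) :
    ∏ i ∈ Finset.range k, wfac q s (n + m * (i : ℤ)) =
      (-1 : K) ^ ((k : ℤ) * n + (k.choose 2 : ℤ) * m) *
      s ^ ((k : ℤ) * (n - 1) + (k.choose 2 : ℤ) * m) *
      q ^ ((k : ℤ) * tri n + (k.choose 2 : ℤ) * (tri m + n * m) + (k.choose 3 : ℤ) * m ^ 2) := by
  have h3 : (-1 : K) ≠ 0 := by simp
  induction k with
  | zero => simp
  | succ k ih =>
    rw [Finset.prod_range_succ, ih, wfac, tri_add, tri_mul, Nat.choose_succ_succ' k 1,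
      Nat.choose_succ_succ' k 2]
    symm
    apply comb h3 hs hq
    all_goals
      push_cast [Nat.choose_one_right]
      ring

theorem prod_w2 (q s : K) (hq : q ≠ 0) (hs : s ≠ 0) (n : ℤ) (m k : ℕ) :
    ∏ i ∈ Finset.range k, wfac q s (n + m * (i : ℤ)) ^ (k - i) =
      (-1 : K) ^ (((k + 1).choose 2 : ℤ) * n + ((k + 1).choose 3 : ℤ) * m) *
      s ^ (((k + 1).choose 2 : ℤ) * (n - 1) + ((k + 1).choose 3 : ℤ) * m) *
      q ^ (((k + 1).choose 2 : ℤ) * tri n + ((k + 1).choose 3 : ℤ) * (tri m + n * m)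
        + ((k + 1).choose 4 : ℤ) * m ^ 2) := by
  have h3 : (-1 : K) ≠ 0 := by simp
  induction k with
  | zero => simp [Nat.choose]
  | succ k ih =>
    have key : ∏ i ∈ Finset.range (k + 1), wfac q s (n + m * (i : ℤ)) ^ (k + 1 - i) =
        (∏ i ∈ Finset.range k, wfac q s (n + m * (i : ℤ)) ^ (k - i)) *
          ∏ i ∈ Finset.range (k + 1), wfac q s (n + m * (i : ℤ)) := by
      rw [Finset.prod_range_succ, Finset.prod_range_succ _ k, ← mul_assoc,
        ← Finset.prod_mul_distrib]
      congr 1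
      · apply Finset.prod_congr rfl
        intro i hi
        have := Finset.mem_range.1 hi
        rw [← pow_succ]
        congr 1
        omega
      · simp
    rw [key, ih, prod_w q s hq hs, Nat.choose_succ_succ' (k + 1) 1,
      Nat.choose_succ_succ' (k + 1) 2, Nat.choose_succ_succ' (k + 1) 3]
    symm
    apply comb h3 hs hq
    all_goals
      push_cast [Nat.choose_one_right]
      ring

theorem Ddet_eval (q x s : K) (hq : q ≠ 0) (hs : s ≠ 0)
    (m k : ℕ) (hm : 1 ≤ m) (hk : 1 ≤ k) (n : ℤ) :
    Ddet q x s n m k =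
      (-1 : K) ^ (((k + 1).choose 2 : ℤ) * n + ((k + 1).choose 3 : ℤ) * m) *
      s ^ (((k + 1).choose 2 : ℤ) * (n - 1) + ((k + 1).choose 3 : ℤ) * m) *
      q ^ (((k + 1).choose 2 : ℤ) * (n * (n - 1) / 2) +
           ((k + 1).choose 3 : ℤ) * ((m : ℤ) * ((m : ℤ) - 1) / 2 + n * m) +
           ((k + 1).choose 4 : ℤ) * m ^ 2) *
      ∏ j ∈ Finset.range k, qFac q x (q ^ (m * (j : ℤ) + n) * s) (k - j) m := by
  have hdet : Ddet q x s n m k = ∏ i : Fin (k + 1), ∏ j ∈ Finset.Ioi i,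
      (wfac q s (n + m * ((i : ℕ) : ℤ)) *
        qFib q x (q ^ (n + m * ((i : ℕ) : ℤ)) * s) (((j : ℕ) - (i : ℕ) : ℕ) * m : ℕ)) := by
    have e : Ddet q x s n m k = (Matrix.projVandermonde
        (fun i : Fin (k + 1) => qFib q x s (n + m * (i : ℕ)))
        (fun i : Fin (k + 1) => qFib q x (q * s) (n + m * (i : ℕ) - 1))).det := by
      unfold Ddet
      congr 1
      ext i j
      simp [Matrix.projVandermonde_apply, Fin.val_rev]
    rw [e, Matrix.det_projVandermonde]
    apply Finset.prod_congr rfl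
    intro i _
    apply Finset.prod_congr rfl
    intro j hj
    have hij : (i : ℕ) ≤ j := by
      have := Finset.mem_Ioi.1 hj
      exact this.le
    rw [← cross q x s hq hs]
    have : n + (m : ℤ) * ((i : ℕ) : ℤ) + ((((j : ℕ) - (i : ℕ)) * m : ℕ) : ℤ) =
        n + m * ((j : ℕ) : ℤ) := by
      push_cast [Nat.cast_sub hij]
      ring
    rw [this]
  have hin : ∀ i : Fin (k + 1), ∏ j ∈ Finset.Ioi i,
      (wfac q s (n + m * ((i : ℕ) : ℤ)) *
        qFib q x (q ^ (n + m * ((i : ℕ) : ℤ)) * s) (((j : ℕ) - (i : ℕ) : ℕ) * m : ℕ)) =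
      wfac q s (n + m * ((i : ℕ) : ℤ)) ^ (k - (i : ℕ)) *
        qFac q x (q ^ (m * ((i : ℕ) : ℤ) + n) * s) (k - (i : ℕ)) m := by
    intro i
    rw [Finset.prod_mul_distrib, Finset.prod_const, Fin.card_Ioi, add_comm n]
    congr 1
    unfold qFac
    symm
    refine Finset.prod_bij (fun a ha => (⟨i + 1 + a, by
      have := Finset.mem_range.1 ha; omega⟩ : Fin (k + 1))) ?_ ?_ ?_ ?_
    · intro a ha
      rw [Finset.mem_Ioi, Fin.lt_def]
      simp only
      omega
    · intro a ha b hb h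
      simp only [Fin.mk.injEq] at h
      omega
    · intro b hb
      have hb' : (i : ℕ) < b := Fin.lt_def.1 (Finset.mem_Ioi.1 hb)
      refine ⟨b - i - 1, ?_, ?_⟩
      · rw [Finset.mem_range]
        have := b.2
        omega
      · apply Fin.ext
        simp only
        omega
    · intro a ha
      have : (i : ℕ) + 1 + a - i = a + 1 := by omega
      simp only [this]
      push_cast
      rfl
  rw [hdet, Finset.prod_congr rfl (fun i _ => hin i),
    Fin.prod_univ_eq_prod_range (fun i => wfac q s (n + m * (i : ℤ)) ^ (k - i) *
        qFac q x (q ^ (m * (i : ℤ) + n) * s) (k - i) m) (k + 1),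
    Finset.prod_range_succ, Finset.prod_mul_distrib, prod_w2 q s hq hs]
  simp [qFac, tri]
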